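/- Characterization of winning positions in open games: let P be a type of positions, turn : P → Bool (true meaning it is White's turn), moves : P → Set P the set of positions reachable in one legal move, and won : P → Prop the terminal positions already won for White. Let W ⊆ P be the least set (under inclusion) satisfying: (i) if won p then p ∈ W; (ii) if turn p = true and some q ∈ moves p has q ∈ W, then p ∈ W; (iii) if turn p = false, moves p is nonempty, and every q ∈ moves p has q ∈ W, then p ∈ W. Then p ∈ W if and only if White has a winning strategy from p, i.e., there is a function s : P → P with s r ∈ moves r whenever turn r = true, ¬ won r, and moves r is nonempty, such that every infinite or maximal play p = p₀, p₁, p₂, … from p in which White's moves follow s (p_{k+1} = s p_k whenever turn p_k = true, ¬ won p_k, and moves p_k ≠ ∅, and p_{k+1} ∈ moves p_k whenever turn p_k = false and ¬ won p_k) reaches some position p_m with won p_m after finitely many steps. -/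

import Mathlib

/-- `s` is a legal strategy for White: at any position `r` where it is White's
turn, White has not already won, and there is a legal move, `s` selects a legal
move. -/
def WhiteStrategyLegal {P : Type*} (turn : P → Bool) (moves : P → Set P)
    (won : P → Prop) (s : P → P) : Prop :=
  ∀ r, turn r = true → ¬ won r → (moves r).Nonempty → s r ∈ moves r

/-- `f : ℕ → P` encodes a (finite maximal or infinite) play from `p` in which
White's moves follow the strategy `s`: it starts at `p`; it stalls (repeats the
current position forever) exactly at won positions and at positions with no
legal moves, thereby encoding finite maximal plays; at White-to-move positions
that are not won and have a legal move it follows `s`; and at Black-to-move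
positions that are not won and have a legal move it makes some legal move. -/
def PlayFollowingWhite {P : Type*} (turn : P → Bool) (moves : P → Set P)
    (won : P → Prop) (s : P → P) (p : P) (f : ℕ → P) : Prop :=
  f 0 = p ∧
    (∀ k, won (f k) ∨ ¬(moves (f k)).Nonempty → f (k + 1) = f k) ∧
    (∀ k, ¬ won (f k) → (moves (f k)).Nonempty → turn (f k) = true →
      f (k + 1) = s (f k)) ∧
    (∀ k, ¬ won (f k) → (moves (f k)).Nonempty → turn (f k) = false →
      f (k + 1) ∈ moves (f k))

universe u

/-- `WinsBelow turn moves won α p` says that `p` is won for White with game value at most `α`. -/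
inductive WinsBelow {P : Type u} (turn : P → Bool) (moves : P → Set P) (won : P → Prop) :
    Ordinal.{u} → P → Prop
  | of_won {α : Ordinal.{u}} {p : P} : won p → WinsBelow turn moves won α p
  | white {α β : Ordinal.{u}} {p q : P} : turn p = true → q ∈ moves p → β < α →
      WinsBelow turn moves won β q → WinsBelow turn moves won α p
  | black {α : Ordinal.{u}} {p : P} (v : P → Ordinal.{u}) : turn p = false →
      (moves p).Nonempty → (∀ q ∈ moves p, v q < α) →
      (∀ q ∈ moves p, WinsBelow turn moves won (v q) q) → WinsBelow turn moves won α p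

section OpenGame

variable {P : Type u} {turn : P → Bool} {moves : P → Set P} {won : P → Prop}

theorem WinsBelow.exists_of_forall_moves {p : P} (hp : turn p = false)
    (hne : (moves p).Nonempty) (h : ∀ q ∈ moves p, ∃ α, WinsBelow turn moves won α q) :
    ∃ α, WinsBelow turn moves won α p := by
  choose! v hv using h
  exact ⟨⨆ q, Order.succ (v q), .black v hp hne
    (fun q _ => (Order.lt_succ (v q)).trans_le (Ordinal.le_iSup (fun q => Order.succ (v q)) q)) hv⟩

/-- A single positional strategy strictly decreases every bound on the game value. -/
theorem WinsBelow.exists_strategy (turn : P → Bool) (moves : P → Set P) (won : P → Prop) :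
    ∃ s : P → P, WhiteStrategyLegal turn moves won s ∧
      ∀ r α, turn r = true → ¬ won r → WinsBelow turn moves won α r →
        ∃ β < α, WinsBelow turn moves won β (s r) := by
  have key : ∀ r, ∃ q, (turn r = true → ¬ won r → (moves r).Nonempty → q ∈ moves r) ∧
      ∀ α, turn r = true → ¬ won r → WinsBelow turn moves won α r →
        ∃ β < α, WinsBelow turn moves won β q := by
    intro r
    by_cases hW : turn r = true ∧ ¬ won r ∧ ∃ α, WinsBelow turn moves won α r
    · obtain ⟨ht, hw, hα⟩ := hW
      have hmin : WinsBelow turn moves won (sInf {α | WinsBelow turn moves won α r}) r :=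
        csInf_mem (s := {α | WinsBelow turn moves won α r}) hα
      cases hmin with
      | of_won h => exact absurd h hw
      | white _ hq hlt hwin =>
        exact ⟨_, fun _ _ _ => hq, fun α _ _ h => ⟨_, hlt.trans_le (csInf_le' h), hwin⟩⟩
      | black v hf => simp [ht] at hf
    · by_cases hne : (moves r).Nonempty
      · exact ⟨hne.some, fun _ _ _ => hne.some_mem, fun α ht hw h => absurd ⟨ht, hw, α, h⟩ hW⟩
      · exact ⟨r, fun _ _ h => absurd h hne, fun α ht hw h => absurd ⟨ht, hw, α, h⟩ hW⟩
  choose s hs using key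
  exact ⟨s, fun r => (hs r).1, fun r => (hs r).2⟩

theorem PlayFollowingWhite.exists_won {s : P → P}
    (hs : ∀ r α, turn r = true → ¬ won r → WinsBelow turn moves won α r →
      ∃ β < α, WinsBelow turn moves won β (s r))
    {p : P} {f : ℕ → P} (hf : PlayFollowingWhite turn moves won s p f)
    {α : Ordinal.{u}} {k : ℕ} (h : WinsBelow turn moves won α (f k)) : ∃ m, won (f m) := by
  induction α using WellFoundedLT.induction generalizing k with
  | ind α ih =>
    by_cases hw : won (f k)
    · exact ⟨k, hw⟩
    obtain ⟨-, -, hfw, hfb⟩ := hf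
    cases h with
    | of_won h => exact ⟨k, h⟩
    | white ht hq hlt hwin =>
      obtain ⟨β, hβ, hβw⟩ := hs _ _ ht hw (.white ht hq hlt hwin)
      rw [← hfw k hw ⟨_, hq⟩ ht] at hβw
      exact ih β hβ hβw
    | black v ht hne hlt hwin =>
      have hmem := hfb k hw hne ht
      exact ih _ (hlt _ hmem) (hwin _ hmem)

/-- Outside a set closed under the winning rules, Black can keep the play outside it forever. -/
theorem exists_playFollowingWhite_notMem {W : Set P}
    (hWon : ∀ p, won p → p ∈ W)
    (hWhite : ∀ p, turn p = true → (∃ q ∈ moves p, q ∈ W) → p ∈ W)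
    (hBlack : ∀ p, turn p = false → (moves p).Nonempty → (∀ q ∈ moves p, q ∈ W) → p ∈ W)
    {s : P → P} (hs : WhiteStrategyLegal turn moves won s) {p : P} (hp : p ∉ W) :
    ∃ f : ℕ → P, PlayFollowingWhite turn moves won s p f ∧ ∀ k, f k ∉ W := by
  have key : ∀ r : {r // r ∉ W}, ∃ q : {r // r ∉ W},
      (¬ (moves r).Nonempty → q = r) ∧
      ((moves r).Nonempty → turn r = true → (q : P) = s r) ∧
      ((moves r).Nonempty → turn r = false → (q : P) ∈ moves r) := by
    rintro ⟨r, hr⟩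
    by_cases hne : (moves r).Nonempty
    · cases ht : turn r with
      | true =>
        have hsr := hs r ht (fun h => hr (hWon r h)) hne
        exact ⟨⟨s r, fun h => hr (hWhite r ht ⟨_, hsr, h⟩)⟩, by simp [hne]⟩
      | false =>
        obtain ⟨q, hq, hqW⟩ : ∃ q ∈ moves r, q ∉ W := by
          by_contra! h
          exact hr (hBlack r ht hne h)
        exact ⟨⟨q, hqW⟩, by simp [hne, hq]⟩
    · exact ⟨⟨r, hr⟩, by simp [hne]⟩
  choose step hstall hwhite hblack using key
  let g : ℕ → {r // r ∉ W} := fun k => step^[k] ⟨p, hp⟩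
  have hg : ∀ k, g (k + 1) = step (g k) := fun k => Function.iterate_succ_apply' step k _
  refine ⟨fun k => g k, ⟨rfl, fun k h => ?_, fun k _ hne ht => ?_, fun k _ hne ht => ?_⟩,
    fun k => (g k).2⟩
  · have hne := h.resolve_left fun h => (g k).2 (hWon _ h)
    simp only [hg, hstall _ hne]
  · simpa only [hg] using hwhite _ hne ht
  · simpa only [hg] using hblack _ hne ht

end OpenGame

/-- Characterization of winning positions in open games: if `W` is the least
set of positions closed under (i) containing the already-won positions,
(ii) containing White-to-move positions with some move into `W`, and
(iii) containing Black-to-move positions having a move, all of whose moves lead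
into `W`, then `W` consists exactly of the positions from which White has a
winning strategy: a strategy `s` such that every infinite or maximal play
following `s` reaches a won position after finitely many steps. -/
theorem mem_leastWinningSet_iff_whiteHasWinningStrategy
    {P : Type*} (turn : P → Bool) (moves : P → Set P) (won : P → Prop)
    (W : Set P)
    (hWon : ∀ p, won p → p ∈ W)
    (hWhite : ∀ p, turn p = true → (∃ q ∈ moves p, q ∈ W) → p ∈ W)
    (hBlack : ∀ p, turn p = false → (moves p).Nonempty →
      (∀ q ∈ moves p, q ∈ W) → p ∈ W)
    (hLeast : ∀ W' : Set P,
      (∀ p, won p → p ∈ W') →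
      (∀ p, turn p = true → (∃ q ∈ moves p, q ∈ W') → p ∈ W') →
      (∀ p, turn p = false → (moves p).Nonempty →
        (∀ q ∈ moves p, q ∈ W') → p ∈ W') →
      W ⊆ W')
    (p : P) :
    p ∈ W ↔
      ∃ s : P → P, WhiteStrategyLegal turn moves won s ∧
        ∀ f : ℕ → P, PlayFollowingWhite turn moves won s p f →
          ∃ m, won (f m) := by
  constructor
  · intro hp
    obtain ⟨α, hα⟩ : ∃ α, WinsBelow turn moves won α p :=
      hLeast {p | ∃ α, WinsBelow turn moves won α p} (fun _ h => ⟨0, .of_won h⟩)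
        (fun _ ht ⟨_, hq, α, hα⟩ => ⟨Order.succ α, .white ht hq (Order.lt_succ α) hα⟩)
        (fun _ => WinsBelow.exists_of_forall_moves) hp
    obtain ⟨s, hs, hdec⟩ := WinsBelow.exists_strategy turn moves won
    exact ⟨s, hs, fun f hf => hf.exists_won hdec (k := 0) (hf.1.symm ▸ hα)⟩
  · rintro ⟨s, hs, hwin⟩
    by_contra hp
    obtain ⟨f, hf, hfW⟩ := exists_playFollowingWhite_notMem hWon hWhite hBlack hs hp
    obtain ⟨m, hm⟩ := hwin f hf
    exact hfW m (hWon _ hm)
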